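/- Let β > 0 and h > 0 be such that (β, h) satisfies the AT condition. Then the map h ↦ q_{β,h} is differentiable at h, and, writing X = β·g·√q_{β,h} + h with g ~ N(0,1), its derivative equals q'(h) = 2·E[tanh(X)·sech²(X)] / ( 1 − β²·E[sech⁴(X) − 2·sech²(X)·tanh²(X)] ). Consequently q'(h) > 0. -/

import Mathlib

open MeasureTheory ProbabilityTheory

noncomputable section

/-- Standard Gaussian measure on `ℝ`. -/
def stdGaussian : Measure ℝ := gaussianReal 0 1

/-- The overlap constant `q_{β,h}`, the unique solution in `(0,1]` of the replica-symmetric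
fixed point equation (set to `0` for `h = 0`). -/
def qOverlap (β h : ℝ) : ℝ :=
  if h = 0 then 0 else
    sSup {q : ℝ | q ∈ Set.Ioc (0 : ℝ) 1 ∧
      q = ∫ g, Real.tanh (β * g * Real.sqrt q + h) ^ 2 ∂stdGaussian}

/-- `q₁(β,h) = E tanh(β g √q_{β,h} + h)`. -/
def q1 (β h : ℝ) : ℝ :=
  ∫ g, Real.tanh (β * g * Real.sqrt (qOverlap β h) + h) ∂stdGaussian

/-- Hyperbolic secant. -/
def sech (x : ℝ) : ℝ := 1 / Real.cosh x

/-- The Almeida–Thouless condition for `(β,h)`. -/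
def ATCond (β h : ℝ) : Prop :=
  β ^ 2 * ∫ g, sech (β * g * Real.sqrt (qOverlap β h) + h) ^ 4 ∂stdGaussian < 1

/-- The AT condition with gap at least `g0`. -/
def ATgap (β h g0 : ℝ) : Prop :=
  β ^ 2 * ∫ g, sech (β * g * Real.sqrt (qOverlap β h) + h) ^ 4 ∂stdGaussian ≤ 1 - g0

/-- The one-dimensional RGD/AMP update map `f_{β,λ}`. -/
def fbl (β lam z : ℝ) : ℝ :=
  ∫ g, Real.tanh (β * g * Real.sqrt (qOverlap β (β * lam * z)) + β * lam * z) ∂stdGaussian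

/-- `h_* = inf{h ≥ 0 : (β,h) satisfies AT}`. -/
def hStar (β : ℝ) : ℝ := sInf {h : ℝ | 0 ≤ h ∧ ATCond β h}

open Filter Topology Asymptotics in
/-- Implicit differentiation from continuity. -/
theorem aux_implicit {G : ℝ × ℝ → ℝ} {Q : ℝ → ℝ} {h a b : ℝ} (ha : 0 < a)
    (hG : HasFDerivAt G (a • ContinuousLinearMap.fst ℝ ℝ ℝ - b • ContinuousLinearMap.snd ℝ ℝ ℝ)
      (Q h, h))
    (hQ : ContinuousAt Q h) (h0 : ∀ᶠ x in 𝓝 h, G (Q x, x) = 0) :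
    HasDerivAt Q (b / a) h := by
  have hc : Tendsto (fun x => (Q x, x)) (𝓝 h) (𝓝 (Q h, h)) :=
    hQ.prodMk continuousAt_id
  have h00 : G (Q h, h) = 0 := h0.self_of_nhds
  have h1 := (hasFDerivAt_iff_isLittleO.mp hG).comp_tendsto hc
  rw [hasDerivAt_iff_isLittleO, isLittleO_iff]
  intro c hcpos
  set C : ℝ := |b / a| + 1 with hC
  have hCpos : 0 < C := by positivity
  rw [isLittleO_iff] at h1
  have hc' : 0 < a * (c / (c + C)) := by positivity
  filter_upwards [h1 hc', h0] with x hx hx0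
  simp only [Function.comp, hx0, h00, Prod.mk_sub_mk, sub_apply,
    smul_apply, ContinuousLinearMap.coe_fst', ContinuousLinearMap.coe_snd',
    smul_eq_mul, Real.norm_eq_abs, sub_self, zero_sub] at hx ⊢
  set u := Q x - Q h - (x - h) * (b / a) with hu
  set t := x - h with ht
  have e1 : -(a * (Q x - Q h) - b * t) = -(a * u) := by
    rw [hu]; field_simp
  rw [e1, abs_neg, abs_mul, abs_of_pos ha] at hx
  have e2 : ‖(Q x - Q h, t)‖ ≤ |u| + C * |t| := by
    rw [Prod.norm_def]
    apply max_le
    · have : Q x - Q h = u + t * (b / a) := by rw [hu]; ring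
      simp only [Real.norm_eq_abs]
      rw [this]
      refine (abs_add_le _ _).trans ?_
      rw [abs_mul, hC]
      nlinarith [abs_nonneg t]
    · simp only [Real.norm_eq_abs, hC]
      nlinarith [abs_nonneg t, abs_nonneg u, abs_nonneg (b / a), mul_nonneg (abs_nonneg t) (abs_nonneg (b/a))]
  have e3 : |u| ≤ c / (c + C) * (|u| + C * |t|) := by
    have := hx.trans (mul_le_mul_of_nonneg_left e2 hc'.le)
    rw [mul_assoc] at this
    exact le_of_mul_le_mul_left this ha
  have e4 : |u| * (c + C) ≤ c * (|u| + C * |t|) := by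
    rw [div_mul_eq_mul_div, le_div_iff₀ (by positivity)] at e3
    exact e3
  have e5 : C * |u| ≤ C * (c * |t|) := by nlinarith
  exact le_of_mul_le_mul_left e5 hCpos

instance : IsProbabilityMeasure _root_.stdGaussian := by unfold _root_.stdGaussian; infer_instance

theorem sech_sq (x : ℝ) : sech x ^ 2 = 1 - Real.tanh x ^ 2 := by
  have := Real.cosh_sq x
  have h := (Real.cosh_pos x).ne'
  rw [sech, Real.tanh_eq_sinh_div_cosh]
  field_simp
  linarith

theorem hasDerivAt_tanh_aux (x : ℝ) : HasDerivAt Real.tanh (1 - Real.tanh x ^ 2) x := by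
  have h := (Real.cosh_pos x).ne'
  have := (Real.hasDerivAt_sinh x).div (Real.hasDerivAt_cosh x) h
  have e : Real.tanh = Real.sinh / Real.cosh := by
    ext y; exact Real.tanh_eq_sinh_div_cosh y
  rw [e]
  refine this.congr_deriv ?_
  simp only [Pi.div_apply]
  field_simp

@[fun_prop]
theorem continuous_tanh_aux : Continuous Real.tanh :=
  continuous_iff_continuousAt.mpr fun x => (hasDerivAt_tanh_aux x).continuousAt

@[fun_prop]
theorem continuous_sech_aux : Continuous sech := by
  unfold sech
  exact continuous_const.div Real.continuous_cosh fun x => (Real.cosh_pos x).ne'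

theorem integrable_bdd_aux {f : ℝ → ℝ} (hf : Continuous f) {C : ℝ} (hC : ∀ x, |f x| ≤ C) :
    Integrable f stdGaussian :=
  Integrable.of_bound hf.aestronglyMeasurable C (Filter.Eventually.of_forall hC)

theorem std_integral_aux (f : ℝ → ℝ) :
    ∫ x, f x ∂stdGaussian = ∫ x, gaussianPDFReal 0 1 x * f x :=
  integral_gaussianReal_eq_integral_smul one_ne_zero

theorem hasDerivAt_pdf_aux (x : ℝ) :
    HasDerivAt (gaussianPDFReal 0 1) (-(x * gaussianPDFReal 0 1 x)) x := by
  rw [gaussianPDFReal_def]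
  have h1 : HasDerivAt (fun x : ℝ => -(x - 0) ^ 2 / (2 * ((1 : NNReal) : ℝ))) (-x) x := by
    have := (((hasDerivAt_id x).sub_const 0).pow 2).neg.div_const (2 * ((1 : NNReal) : ℝ))
    refine this.congr_deriv ?_
    simp only [id]
    push_cast
    ring
  refine (h1.exp.const_mul _).congr_deriv ?_
  ring

theorem continuous_pdf_aux : Continuous (gaussianPDFReal 0 1) :=
  continuous_iff_continuousAt.mpr fun x => (hasDerivAt_pdf_aux x).continuousAt

theorem integrable_x_pdf_aux : Integrable (fun x : ℝ => x * gaussianPDFReal 0 1 x) := by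
  have := (integrable_mul_exp_neg_mul_sq (b := 1/2) (by norm_num)).const_mul
    (√(2 * Real.pi * ((1 : NNReal) : ℝ)))⁻¹
  convert this using 2 with x
  rw [gaussianPDFReal]
  have : -(x - 0) ^ 2 / (2 * ((1 : NNReal) : ℝ)) = -(1 / 2) * x ^ 2 := by simp; ring
  rw [this]; ring

theorem stein_aux {f f' : ℝ → ℝ} (hf : ∀ x, HasDerivAt f (f' x) x) (hf' : Continuous f')
    {C C' : ℝ} (hC : ∀ x, |f x| ≤ C) (hC' : ∀ x, |f' x| ≤ C') :
    ∫ x, x * f x ∂stdGaussian = ∫ x, f' x ∂stdGaussian := by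
  have hfc : Continuous f := continuous_iff_continuousAt.mpr fun x => (hf x).continuousAt
  have i1 : Integrable (fun x => gaussianPDFReal 0 1 x * f x) :=
    (integrable_gaussianPDFReal 0 1).mul_bdd (c := C) hfc.aestronglyMeasurable
      (Filter.Eventually.of_forall hC)
  have i2 : Integrable (fun x => gaussianPDFReal 0 1 x * f' x) :=
    (integrable_gaussianPDFReal 0 1).mul_bdd (c := C') hf'.aestronglyMeasurable
      (Filter.Eventually.of_forall hC')
  have i3 : Integrable (fun x => (x * gaussianPDFReal 0 1 x) * f x) :=
    integrable_x_pdf_aux.mul_bdd (c := C) hfc.aestronglyMeasurable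
      (Filter.Eventually.of_forall hC)
  have key := integral_eq_zero_of_hasDerivAt_of_integrable
    (f := fun x => gaussianPDFReal 0 1 x * f x)
    (f' := fun x => gaussianPDFReal 0 1 x * f' x - (x * gaussianPDFReal 0 1 x) * f x)
    (fun x => by
      refine ((hasDerivAt_pdf_aux x).mul (hf x)).congr_deriv ?_
      ring) (i2.sub i3) i1
  rw [integral_sub i2 i3, sub_eq_zero] at key
  rw [std_integral_aux, std_integral_aux, key]
  congr 1; ext x; ring

theorem abs_tanh_le_aux (x : ℝ) : |Real.tanh x| ≤ 1 := (Real.abs_tanh_lt_one x).le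

theorem tanh_pos_aux {x : ℝ} (hx : 0 < x) : 0 < Real.tanh x := by
  rw [Real.tanh_eq_sinh_div_cosh]
  exact div_pos (Real.sinh_pos_iff.mpr hx) (Real.cosh_pos x)

theorem pdf_neg_aux (x : ℝ) : gaussianPDFReal 0 1 (-x) = gaussianPDFReal 0 1 x := by
  simp [gaussianPDFReal]

theorem pdf_lt_aux {x y : ℝ} (h : x ^ 2 < y ^ 2) :
    gaussianPDFReal 0 1 y < gaussianPDFReal 0 1 x := by
  simp only [gaussianPDFReal]
  apply mul_lt_mul_of_pos_left _ (by positivity)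
  apply Real.exp_lt_exp.mpr
  simp; linarith

theorem pos_aux {f : ℝ → ℝ} (hf : Continuous f) {C : ℝ} (hC : ∀ x, |f x| ≤ C)
    (hodd : ∀ x, f (-x) = -f x) (hpos : ∀ x, 0 < x → 0 < f x) {σ h : ℝ} (hσ : 0 < σ)
    (hh : 0 < h) : 0 < ∫ g, f (σ * g + h) ∂stdGaussian := by
  set c := h / σ with hc
  have hcpos : 0 < c := by positivity
  have hsc : σ * c = h := by rw [hc]; field_simp
  set p := gaussianPDFReal 0 1 with hp
  have e1 : ∫ g, f (σ * g + h) ∂stdGaussian = ∫ x, p (x - c) * f (σ * x) := by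
    rw [std_integral_aux, ← integral_sub_right_eq_self _ c]
    congr 1; ext x
    congr 2
    rw [mul_sub, hsc]; ring
  have e2 : ∫ g, f (σ * g + h) ∂stdGaussian = - ∫ x, p (x + c) * f (σ * x) := by
    rw [e1, ← integral_neg_eq_self, ← integral_neg]
    congr 1; ext x
    have : p (-x - c) = p (x + c) := by
      rw [hp, ← pdf_neg_aux]; congr 1; ring
    rw [this, mul_neg, hodd]; ring
  have hfc : AEStronglyMeasurable (fun x => f (σ * x)) volume :=
    Continuous.aestronglyMeasurable (by fun_prop)
  have i1 : Integrable (fun x => p (x - c) * f (σ * x)) :=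
    ((integrable_gaussianPDFReal 0 1).comp_sub_right c).mul_bdd (c := C) hfc
      (Filter.Eventually.of_forall fun x => hC _)
  have i2 : Integrable (fun x => p (x + c) * f (σ * x)) :=
    ((integrable_gaussianPDFReal 0 1).comp_add_right c).mul_bdd (c := C) hfc
      (Filter.Eventually.of_forall fun x => hC _)
  have key : 0 < ∫ x, (p (x - c) * f (σ * x) - p (x + c) * f (σ * x)) := by
    have hpp : ∀ x : ℝ, x ≠ 0 → 0 < p (x - c) * f (σ * x) - p (x + c) * f (σ * x) := by
      intro x hx
      rw [← sub_mul]
      rcases lt_or_gt_of_ne hx with h1 | h1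
      · have a1 : p (x - c) < p (x + c) := pdf_lt_aux (by nlinarith)
        have a2 : 0 < f (σ * (-x)) := hpos _ (by apply mul_pos hσ; linarith)
        rw [mul_neg, hodd] at a2
        nlinarith
      · have a1 : p (x + c) < p (x - c) := pdf_lt_aux (by nlinarith)
        have a2 : 0 < f (σ * x) := hpos _ (by positivity)
        apply mul_pos _ a2; linarith
    have hf0 : f 0 = 0 := by have := hodd 0; simp at this; linarith
    refine (integral_pos_iff_support_of_nonneg ?_ (i1.sub i2)).mpr ?_
    rotate_left
    · have : Set.Ioi (0:ℝ) ⊆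
          Function.support (fun x => p (x - c) * f (σ * x) - p (x + c) * f (σ * x)) :=
        fun x hx => (hpp x (ne_of_gt hx)).ne'
      exact lt_of_lt_of_le (by simp) (measure_mono this)
    · intro x
      by_cases hx : x = 0
      · simp [hx, hf0]
      · exact (hpp x hx).le
  rw [integral_sub i1 i2, ← e1] at key
  linarith

/-- `Φ(s,h) = E tanh²(β g s + h)`. -/
def PhiAux (β : ℝ) (p : ℝ × ℝ) : ℝ := ∫ g, Real.tanh (β * g * p.1 + p.2) ^ 2 ∂_root_.stdGaussian

theorem abs_ts_aux (x : ℝ) : |2 * Real.tanh x * (1 - Real.tanh x ^ 2)| ≤ 2 := by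
  have h1 := Real.tanh_sq_lt_one x
  have h2 := abs_tanh_le_aux x
  rw [abs_mul, abs_mul, abs_two, abs_of_pos (by linarith : 0 < 1 - Real.tanh x ^ 2)]
  have h3 : 1 - Real.tanh x ^ 2 ≤ 1 := by nlinarith [sq_nonneg (Real.tanh x)]
  nlinarith [abs_nonneg (Real.tanh x), mul_le_one₀ h2 (by linarith) h3]

theorem integrable_abs_aux : Integrable (fun g : ℝ => |g|) _root_.stdGaussian := by
  have := (memLp_id_gaussianReal (μ := 0) (v := 1) 1)
  have h2 : Integrable (id : ℝ → ℝ) _root_.stdGaussian :=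
    memLp_one_iff_integrable.mp (by simpa [_root_.stdGaussian] using this)
  exact h2.abs

theorem phi_fderiv_aux (β s h : ℝ) : HasFDerivAt (PhiAux β)
    ((∫ g, 2 * Real.tanh (β * g * s + h) * (1 - Real.tanh (β * g * s + h) ^ 2) * (β * g)
        ∂_root_.stdGaussian) • ContinuousLinearMap.fst ℝ ℝ ℝ +
      (∫ g, 2 * Real.tanh (β * g * s + h) * (1 - Real.tanh (β * g * s + h) ^ 2)
        ∂_root_.stdGaussian) • ContinuousLinearMap.snd ℝ ℝ ℝ) (s, h) := by
  set c : ℝ × ℝ → ℝ → ℝ := fun p g =>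
    2 * Real.tanh (β * g * p.1 + p.2) * (1 - Real.tanh (β * g * p.1 + p.2) ^ 2) with hc
  have hcb : ∀ p g, |c p g| ≤ 2 := fun p g => abs_ts_aux _
  have hcc : ∀ p, Continuous (c p) := fun p => by rw [hc]; fun_prop
  have hb : Integrable (fun g : ℝ => 2 * (|β| * |g|) + 2) _root_.stdGaussian :=
    ((integrable_abs_aux.const_mul |β|).const_mul 2).add (integrable_const 2)
  have i2 : Integrable (c (s, h)) _root_.stdGaussian := integrable_bdd_aux (hcc _) (hcb _)
  have i1 : Integrable (fun g => c (s, h) g * (β * g)) _root_.stdGaussian := by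
    refine hb.mono' (Continuous.aestronglyMeasurable ((hcc _).mul (by fun_prop)))
      (Filter.Eventually.of_forall fun g => ?_)
    rw [Real.norm_eq_abs, abs_mul (c (s, h) g), abs_mul β]
    have := hcb (s, h) g
    nlinarith [mul_nonneg (abs_nonneg β) (abs_nonneg g)]
  have key := hasFDerivAt_integral_of_dominated_of_fderiv_le (μ := _root_.stdGaussian) (𝕜 := ℝ)
    (F := fun (p : ℝ × ℝ) g => Real.tanh (β * g * p.1 + p.2) ^ 2)
    (F' := fun p g => (c p g * (β * g)) • ContinuousLinearMap.fst ℝ ℝ ℝ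
      + (c p g) • ContinuousLinearMap.snd ℝ ℝ ℝ) (x₀ := (s, h)) (s := Set.univ)
    (bound := fun g => 2 * (|β| * |g|) + 2) Filter.univ_mem
    (Filter.Eventually.of_forall fun p => Continuous.aestronglyMeasurable (by fun_prop))
    (integrable_bdd_aux (C := 1) (by fun_prop) (fun x => by
      rw [abs_of_nonneg (sq_nonneg _)]; exact (Real.tanh_sq_lt_one _).le))
    (Continuous.aestronglyMeasurable (by
      have := hcc (s, h)
      fun_prop))
    (Filter.Eventually.of_forall fun g p _ => by
      refine (norm_add_le _ _).trans ?_
      rw [norm_smul, norm_smul, Real.norm_eq_abs, Real.norm_eq_abs, abs_mul (c p g),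
        abs_mul β]
      have h1 := ContinuousLinearMap.norm_fst_le ℝ ℝ ℝ
      have h2 := ContinuousLinearMap.norm_snd_le ℝ ℝ ℝ
      have h3 := hcb p g
      have h4 := mul_nonneg (abs_nonneg β) (abs_nonneg g)
      refine add_le_add ?_ ?_
      · calc |c p g| * (|β| * |g|) * ‖ContinuousLinearMap.fst ℝ ℝ ℝ‖
            ≤ 2 * (|β| * |g|) * 1 := by gcongr
          _ = _ := by ring
      · calc |c p g| * ‖ContinuousLinearMap.snd ℝ ℝ ℝ‖ ≤ 2 * 1 := by gcongr
          _ = _ := by ring)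
    hb
    (Filter.Eventually.of_forall fun g p _ => by
      have hl : HasFDerivAt (fun p : ℝ × ℝ => β * g * p.1 + p.2)
          ((β * g) • ContinuousLinearMap.fst ℝ ℝ ℝ + ContinuousLinearMap.snd ℝ ℝ ℝ) p :=
        (hasFDerivAt_fst.const_mul (β * g)).add hasFDerivAt_snd
      have h2 := ((hasDerivAt_tanh_aux (β * g * p.1 + p.2)).pow 2).comp_hasFDerivAt p hl
      refine h2.congr_fderiv ?_
      ext <;> simp [hc])
  rw [integral_add (i1.smul_const _) (i2.smul_const _), integral_smul_const,
    integral_smul_const] at key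
  exact key

theorem phi_cont_aux (β : ℝ) : Continuous (PhiAux β) :=
  continuous_iff_continuousAt.mpr fun p => (phi_fderiv_aux β p.1 p.2).continuousAt

theorem stein_tanh_aux (β s h : ℝ) :
    ∫ g, 2 * Real.tanh (β * g * s + h) * (1 - Real.tanh (β * g * s + h) ^ 2) * (β * g)
        ∂_root_.stdGaussian = 2 * s * (β ^ 2 * ∫ g, (sech (β * g * s + h) ^ 4 -
              2 * sech (β * g * s + h) ^ 2 * Real.tanh (β * g * s + h) ^ 2)
               ∂_root_.stdGaussian) := by
  set K : ℝ → ℝ := fun x => (1 - Real.tanh x ^ 2) ^ 2 - 2 * (1 - Real.tanh x ^ 2) * Real.tanh x ^ 2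
    with hK
  have hd : ∀ x, HasDerivAt (fun x => Real.tanh x * (1 - Real.tanh x ^ 2)) (K x) x := by
    intro x
    have h1 := hasDerivAt_tanh_aux x
    have h2 := h1.mul ((h1.pow 2).const_sub 1)
    refine h2.congr_deriv ?_
    simp [hK]; ring
  have hKb : ∀ x, |K x| ≤ 3 := by
    intro x
    have h1 := Real.tanh_sq_lt_one x
    have h2 := sq_nonneg (Real.tanh x)
    rw [abs_le, hK]
    constructor <;> nlinarith
  have st := stein_aux (f := fun g => 2 * β * (Real.tanh (β * g * s + h) *
      (1 - Real.tanh (β * g * s + h) ^ 2))) (f' := fun g => 2 * β * (K (β * g * s + h) * (β * s)))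
    (C := |β| * 2) (C' := 2 * |β| * (3 * |β * s|))
    (fun g => by
      have hl : HasDerivAt (fun g : ℝ => β * g * s + h) (β * s) g := by
        refine ((((hasDerivAt_id g).const_mul β).mul_const s).add_const h).congr_deriv ?_
        simp
      exact ((hd (β * g * s + h)).comp g hl).const_mul (2 * β))
    (by rw [hK]; fun_prop)
    (fun g => by
      have := abs_ts_aux (β * g * s + h)
      have e : 2 * β * (Real.tanh (β * g * s + h) * (1 - Real.tanh (β * g * s + h) ^ 2)) =
        β * (2 * Real.tanh (β * g * s + h) * (1 - Real.tanh (β * g * s + h) ^ 2)) := by ring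
      rw [e, abs_mul]
      gcongr)
    (fun g => by
      rw [abs_mul, abs_mul, abs_mul, abs_two]
      have := hKb (β * g * s + h)
      gcongr)
  calc _ = ∫ g, g * (2 * β * (Real.tanh (β * g * s + h) *
      (1 - Real.tanh (β * g * s + h) ^ 2))) ∂_root_.stdGaussian := by
        congr 1; ext g; ring
    _ = _ := by
      rw [st, ← mul_assoc, ← integral_const_mul]
      congr 1; ext g
      have e : sech (β * g * s + h) ^ 4 = (sech (β * g * s + h) ^ 2) ^ 2 := by ring
      rw [e, sech_sq, hK]
      ring

/-- `G(q,h) = q - E tanh²(β g √q + h)`. -/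
def GAux (β : ℝ) (p : ℝ × ℝ) : ℝ := p.1 - PhiAux β (√p.1, p.2)

theorem G_cont_aux (β : ℝ) : Continuous (GAux β) := by
  unfold GAux
  have := phi_cont_aux β
  fun_prop

theorem G_fderiv_aux (β q h : ℝ) (hq : 0 < q) : HasFDerivAt (GAux β)
    ((1 - β ^ 2 * ∫ g, (sech (β * g * √q + h) ^ 4 -
              2 * sech (β * g * √q + h) ^ 2 * Real.tanh (β * g * √q + h) ^ 2)
               ∂_root_.stdGaussian) • ContinuousLinearMap.fst ℝ ℝ ℝ -
      (2 * ∫ g, Real.tanh (β * g * √q + h) * sech (β * g * √q + h) ^ 2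
        ∂_root_.stdGaussian) • ContinuousLinearMap.snd ℝ ℝ ℝ) (q, h) := by
  have h1 := phi_fderiv_aux β (√q) h
  rw [stein_tanh_aux] at h1
  have hs : 0 < √q := Real.sqrt_pos.mpr hq
  have h2 : HasFDerivAt (fun p : ℝ × ℝ => (√p.1, p.2))
      (((1 / (2 * √q)) • ContinuousLinearMap.fst ℝ ℝ ℝ).prod (ContinuousLinearMap.snd ℝ ℝ ℝ))
      (q, h) := by
    have := (Real.hasDerivAt_sqrt hq.ne').comp_hasFDerivAt (q, h)
      (hasFDerivAt_fst (𝕜 := ℝ) (p := ((q, h) : ℝ × ℝ)))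
    exact this.prodMk hasFDerivAt_snd
  have h3 := (hasFDerivAt_fst (𝕜 := ℝ) (p := ((q, h) : ℝ × ℝ))).sub
    (HasFDerivAt.comp (q, h) (g := PhiAux β) h1 h2)
  refine h3.congr_fderiv ?_
  have e : ∫ g, 2 * Real.tanh (β * g * √q + h) * (1 - Real.tanh (β * g * √q + h) ^ 2)
        ∂_root_.stdGaussian = 2 * ∫ g, Real.tanh (β * g * √q + h) * sech (β * g * √q + h) ^ 2
        ∂_root_.stdGaussian := by
    rw [← integral_const_mul]
    congr 1; ext g; rw [sech_sq]; ring
  rw [e]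
  ext
  · simp
    field_simp
  · simp

theorem phi_lt_one_aux (β : ℝ) (p : ℝ × ℝ) : PhiAux β p < 1 := by
  have i : Integrable (fun g => Real.tanh (β * g * p.1 + p.2) ^ 2) _root_.stdGaussian :=
    (integrable_bdd_aux (C := 1) (by fun_prop) (fun x => by
      rw [abs_of_nonneg (sq_nonneg _)]; exact (Real.tanh_sq_lt_one _).le))
  have : 0 < ∫ g, (1 - Real.tanh (β * g * p.1 + p.2) ^ 2) ∂_root_.stdGaussian := by
    have hp : ∀ g, 0 < 1 - Real.tanh (β * g * p.1 + p.2) ^ 2 := fun g => by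
      linarith [Real.tanh_sq_lt_one (β * g * p.1 + p.2)]
    refine (integral_pos_iff_support_of_nonneg (fun g => (hp g).le)
      ((integrable_const 1).sub i)).mpr ?_
    have : (Function.support fun g => 1 - Real.tanh (β * g * p.1 + p.2) ^ 2) = Set.univ := by
      ext g; simpa using (hp g).ne'
    rw [this]; simp
  rw [integral_sub (integrable_const 1) i] at this
  simp at this
  exact this

theorem G_one_aux (β h : ℝ) : 0 < GAux β (1, h) := by
  unfold GAux; linarith [phi_lt_one_aux β (√((1, h) : ℝ × ℝ).1, ((1, h) : ℝ × ℝ).2)]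

theorem G_zero_aux (β : ℝ) {h : ℝ} (hh : 0 < h) : GAux β (0, h) < 0 := by
  have := tanh_pos_aux hh
  simp [GAux, PhiAux]
  exact pow_pos this 2

theorem q_spec_aux (β : ℝ) {h : ℝ} (hh : 0 < h) :
    0 < qOverlap β h ∧ qOverlap β h < 1 ∧ GAux β (qOverlap β h, h) = 0 ∧
      ∀ q, 0 ≤ q → q ≤ 1 → GAux β (q, h) = 0 → q ≤ qOverlap β h := by
  set S : Set ℝ := {q | q ∈ Set.Icc (0 : ℝ) 1 ∧ GAux β (q, h) = 0} with hS
  have hqS : qOverlap β h = sSup S := by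
    rw [qOverlap, if_neg hh.ne']
    congr 1
    ext q
    simp only [hS, Set.mem_ofPred_eq, Set.mem_Icc, Set.mem_Ioc, GAux, PhiAux, sub_eq_zero]
    constructor
    · rintro ⟨⟨h1, h2⟩, h3⟩; exact ⟨⟨h1.le, h2⟩, h3⟩
    · rintro ⟨⟨h1, h2⟩, h3⟩
      refine ⟨⟨lt_of_le_of_ne h1 ?_, h2⟩, h3⟩
      rintro rfl
      have := G_zero_aux β hh
      simp only [GAux, PhiAux] at this
      linarith
  have hcont : Continuous (fun q => GAux β (q, h)) := (G_cont_aux β).comp (by fun_prop)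
  have hcomp : IsCompact S :=
    isCompact_Icc.inter_right (isClosed_eq hcont continuous_const)
  have hne : S.Nonempty := by
    obtain ⟨q, hq, hq0⟩ := intermediate_value_Icc zero_le_one hcont.continuousOn
      ⟨(G_zero_aux β hh).le, (G_one_aux β h).le⟩
    exact ⟨q, hq, hq0⟩
  have hmem := hcomp.sSup_mem hne
  rw [← hqS] at hmem
  obtain ⟨⟨h1, h2⟩, h3⟩ := hmem
  refine ⟨lt_of_le_of_ne h1 ?_, lt_of_le_of_ne h2 ?_, h3, ?_⟩
  · intro e; rw [← e] at h3; linarith [G_zero_aux β hh]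
  · intro e; rw [e] at h3; linarith [G_one_aux β h]
  · intro q a b c
    rw [hqS]
    exact le_csSup hcomp.bddAbove ⟨⟨a, b⟩, c⟩

open Filter Topology in
theorem q_cont_aux (β : ℝ) {h a b : ℝ} (hh : 0 < h) (ha : 0 < a)
    (hG : HasFDerivAt (GAux β)
      (a • ContinuousLinearMap.fst ℝ ℝ ℝ - b • ContinuousLinearMap.snd ℝ ℝ ℝ)
      (qOverlap β h, h)) : ContinuousAt (qOverlap β) h := by
  obtain ⟨hq0, hq1, hGq, hmax⟩ := q_spec_aux β hh
  set q0 := qOverlap β h with hq0def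
  have hcont : ∀ h', Continuous (fun q => GAux β (q, h')) := fun h' =>
    (G_cont_aux β).comp (by fun_prop)
  have hpos : ∀ᶠ x in 𝓝 h, 0 < x := lt_mem_nhds hh
  -- values above are positive
  have habove : ∀ q, q0 < q → q ≤ 1 → 0 < GAux β (q, h) := by
    intro q h1 h2
    by_contra hcon
    push Not at hcon
    obtain ⟨r, hr, hr0⟩ := intermediate_value_Icc h2 (hcont h).continuousOn
      ⟨hcon, (G_one_aux β h).le⟩
    have := hmax r (by linarith [hr.1]) hr.2 hr0
    linarith [hr.1]
  have hderiv : HasDerivAt (fun q => GAux β (q, h)) a q0 := by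
    have h2 : HasDerivAt (fun q : ℝ => (q, h)) ((1 : ℝ), (0 : ℝ)) q0 :=
      (hasDerivAt_id q0).prodMk (hasDerivAt_const q0 h)
    refine (HasFDerivAt.comp_hasDerivAt q0 hG h2).congr_deriv ?_
    simp
  -- values slightly below are negative
  have hbelow : ∀ᶠ q in 𝓝[<] q0, GAux β (q, h) < 0 := by
    have h1 := (hasDerivAt_iff_tendsto_slope.mp hderiv).mono_left
      (nhdsWithin_mono q0 (fun x (hx : x < q0) => ne_of_lt hx))
    have h2 : ∀ᶠ q in 𝓝[<] q0, 0 < slope (fun q => GAux β (q, h)) q0 q :=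
      h1.eventually (lt_mem_nhds ha)
    filter_upwards [h2, self_mem_nhdsWithin] with q h3 h4
    rw [slope_def_field, hGq, sub_zero] at h3
    have h5 : q - q0 < 0 := sub_neg.mpr h4
    by_contra hcon
    push Not at hcon
    linarith [div_nonpos_of_nonneg_of_nonpos hcon h5.le]
  rw [ContinuousAt, tendsto_order]
  constructor
  · intro l hl
    obtain ⟨q, hq, hql⟩ := (hbelow.and (Ioo_mem_nhdsLT (max_lt hl hq0))).exists
    have h1 : ∀ᶠ x in 𝓝 h, GAux β (q, x) < 0 := by
      have hc : Continuous (fun x => GAux β (q, x)) := (G_cont_aux β).comp (by fun_prop)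
      exact hc.continuousAt.eventually (gt_mem_nhds hq)
    filter_upwards [h1, hpos] with x hx hx0
    have hl1 := (max_lt_iff.mp hql.1).1
    have hl2 := (max_lt_iff.mp hql.1).2
    have hq1' : q ≤ 1 := by linarith [hql.2]
    obtain ⟨r, hr, hr0⟩ := intermediate_value_Icc hq1' (hcont x).continuousOn
      ⟨hx.le, (G_one_aux β x).le⟩
    have := (q_spec_aux β hx0).2.2.2 r (by linarith [hr.1]) hr.2 hr0
    linarith [hr.1]
  · intro u hu
    have h1 : ∀ᶠ x in 𝓝 h, ∀ q ∈ Set.Icc u 1, 0 < GAux β (q, x) := by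
      refine isCompact_Icc.eventually_forall_of_forall_eventually
        (P := fun x q => 0 < GAux β (q, x)) ?_
      intro q hq
      have hc : Continuous (fun z : ℝ × ℝ => GAux β (z.2, z.1)) :=
        (G_cont_aux β).comp (by fun_prop)
      exact (hc.continuousAt (x := (h, q))).eventually
        (lt_mem_nhds (habove q (lt_of_lt_of_le hu hq.1) hq.2))
    filter_upwards [h1, hpos] with x hx hx0
    by_contra hcon
    push Not at hcon
    obtain ⟨_, a2, a3, _⟩ := q_spec_aux β hx0
    linarith [hx _ ⟨hcon, a2.le⟩]

/-- If `(β,h)` satisfies the AT condition with `β, h > 0`, then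
`h ↦ q_{β,h}` is differentiable at `h`, with derivative given by the explicit formula, and
the derivative is strictly positive. -/
theorem stmt13 (β h : ℝ) (hβ : 0 < β) (hh : 0 < h) (hAT : ATCond β h) :
    ∃ D : ℝ,
      D = 2 * (∫ g, Real.tanh (β * g * Real.sqrt (qOverlap β h) + h) *
              sech (β * g * Real.sqrt (qOverlap β h) + h) ^ 2 ∂stdGaussian) /
          (1 - β ^ 2 * ∫ g, sech (β * g * Real.sqrt (qOverlap β h) + h) ^ 4 -
              2 * sech (β * g * Real.sqrt (qOverlap β h) + h) ^ 2 *
                Real.tanh (β * g * Real.sqrt (qOverlap β h) + h) ^ 2 ∂stdGaussian) ∧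
      HasDerivAt (fun h' => qOverlap β h') D h ∧ 0 < D := by
  obtain ⟨hq0, hq1, hGq, hmax⟩ := q_spec_aux β hh
  have hG := G_fderiv_aux β (qOverlap β h) h hq0
  have hs : 0 < √(qOverlap β h) := Real.sqrt_pos.mpr hq0
  have hnum : 0 < ∫ g, Real.tanh (β * g * √(qOverlap β h) + h) *
      sech (β * g * √(qOverlap β h) + h) ^ 2 ∂_root_.stdGaussian := by
    have := pos_aux (f := fun x => Real.tanh x * sech x ^ 2) (by fun_prop) (C := 1)
      (fun x => by
        rw [sech_sq]
        have := abs_ts_aux x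
        rw [mul_assoc, abs_mul, abs_two] at this
        linarith)
      (fun x => by simp [sech])
      (fun x hx => by
        rw [sech_sq]
        exact mul_pos (tanh_pos_aux hx) (by linarith [Real.tanh_sq_lt_one x]))
      (mul_pos hβ hs) hh
    refine this.trans_le (le_of_eq ?_)
    congr 1; ext g
    have : β * √(qOverlap β h) * g + h = β * g * √(qOverlap β h) + h := by ring
    rw [this]
  have hden : 0 < 1 - β ^ 2 * ∫ g, (sech (β * g * √(qOverlap β h) + h) ^ 4 -
      2 * sech (β * g * √(qOverlap β h) + h) ^ 2 *
        Real.tanh (β * g * √(qOverlap β h) + h) ^ 2) ∂_root_.stdGaussian := by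
    have hb : ∀ x, sech x ^ 2 ≤ 1 ∧ 0 ≤ sech x ^ 2 ∧ 0 ≤ Real.tanh x ^ 2 := fun x =>
      ⟨by rw [sech_sq]; linarith [sq_nonneg (Real.tanh x)], sq_nonneg _, sq_nonneg _⟩
    have hb4 : ∀ x, sech x ^ 4 ≤ 1 := fun x => by
      have := hb x
      nlinarith
    have hb5 : ∀ x, 0 ≤ sech x ^ 4 := fun x => by positivity
    have hle : ∫ g, (sech (β * g * √(qOverlap β h) + h) ^ 4 -
      2 * sech (β * g * √(qOverlap β h) + h) ^ 2 *
        Real.tanh (β * g * √(qOverlap β h) + h) ^ 2) ∂_root_.stdGaussian ≤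
        ∫ g, sech (β * g * √(qOverlap β h) + h) ^ 4 ∂_root_.stdGaussian := by
      apply integral_mono
      · refine integrable_bdd_aux (C := 2) (by fun_prop) (fun g => ?_)
        have h1 := hb (β * g * √(qOverlap β h) + h)
        have h2 := hb4 (β * g * √(qOverlap β h) + h)
        have h3 := hb5 (β * g * √(qOverlap β h) + h)
        have h4 := (Real.tanh_sq_lt_one (β * g * √(qOverlap β h) + h)).le
        have h5 := mul_le_one₀ h1.1 h1.2.2 h4
        have h6 := mul_nonneg h1.2.1 h1.2.2
        rw [abs_le]
        constructor <;> nlinarith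
      · refine integrable_bdd_aux (C := 1) (by fun_prop) (fun g => ?_)
        rw [abs_of_nonneg (hb5 _)]; exact hb4 _
      · intro g
        have h1 := hb (β * g * √(qOverlap β h) + h)
        have h6 := mul_nonneg h1.2.1 h1.2.2
        simp only
        linarith
    have hAT' := hAT
    unfold ATCond at hAT'
    have := mul_le_mul_of_nonneg_left hle (sq_nonneg β)
    linarith
  refine ⟨_, rfl, ?_, by positivity⟩
  refine aux_implicit hden hG (q_cont_aux β hh hden hG) ?_
  filter_upwards [lt_mem_nhds hh] with x hx
  exact (q_spec_aux β hx).2.2.1
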